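/- Let d, a, b, c, e, b', c', e' be complex numbers with Re(a) > 0, Re(d-a) > 0, Re(d+e-a-b-c) > 0 and Re(e'-b'-c') > 0 (no denominator parameter a nonpositive integer). Then Σ_{m,n≥0} (a)_m(b)_m(c)_m (d-a)_n(b')_n(c')_n / ((d)_{m+n}(e)_m(e')_n m! n!) = [Γ(d)Γ(d+e-a-b-c) / (Γ(d-a)Γ(d+e-b-c))] · Σ_{m,n≥0} (a)_m(e-b)_m(e-c)_m (b')_n(c')_n(d+e-a-b-c)_n / ((e)_m (e')_n (d+e-b-c)_{m+n} m! n!). -/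

import Mathlib

open Complex Finset

/-- Pochhammer symbol `(a)_k = a(a+1)⋯(a+k-1)`. -/
noncomputable def poch (a : ℂ) (k : ℕ) : ℂ := ∏ i ∈ Finset.range k, (a + i)

/-- `z` is not a nonpositive integer. -/
def notNonposInt (z : ℂ) : Prop := ∀ k : ℕ, z ≠ -(k : ℂ)

open Filter Topology Asymptotics MeasureTheory

lemma poch_zero (a : ℂ) : poch a 0 = 1 := by simp [poch]

lemma poch_succ (a : ℂ) (k : ℕ) : poch a (k + 1) = poch a k * (a + k) := by
  simp [poch, Finset.prod_range_succ]

lemma poch_ne_zero {a : ℂ} (h : notNonposInt a) (k : ℕ) : poch a k ≠ 0 := by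
  rw [poch, Finset.prod_ne_zero_iff]
  intro i _ hi
  exact h i (by linear_combination hi)

lemma notNonposInt_of_re_pos {a : ℂ} (h : 0 < a.re) : notNonposInt a := by
  intro k hk
  rw [hk] at h
  simp at h
  linarith [(Nat.cast_nonneg k : (0:ℝ) ≤ k)]

/-- coefficients of the Gauss hypergeometric series -/
noncomputable def hcoef (b c e : ℂ) (m : ℕ) : ℂ :=
  poch b m * poch c m / (poch e m * (Nat.factorial m : ℂ))

lemma hcoef_succ (b c : ℂ) {e : ℂ} (he : notNonposInt e) (m : ℕ) :
    hcoef b c e (m + 1) * ((m + 1) * (e + m)) = (b + m) * (c + m) * hcoef b c e m := by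
  have h1 := poch_ne_zero he m
  have h2 : (Nat.factorial m : ℂ) ≠ 0 := by exact_mod_cast Nat.factorial_ne_zero m
  have h3 : e + m ≠ 0 := fun h => he m (by linear_combination h)
  have h4 : (m : ℂ) + 1 ≠ 0 := by exact_mod_cast Nat.succ_ne_zero m
  simp only [hcoef, poch_succ, Nat.factorial_succ]
  push_cast
  field_simp

noncomputable def bcoef (s : ℂ) (m : ℕ) : ℂ := poch s m / (Nat.factorial m : ℂ)

lemma bcoef_succ (s : ℂ) (m : ℕ) :
    bcoef s (m + 1) * (m + 1) = (s + m) * bcoef s m := by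
  have h2 : (Nat.factorial m : ℂ) ≠ 0 := by exact_mod_cast Nat.factorial_ne_zero m
  have h4 : (m : ℂ) + 1 ≠ 0 := by exact_mod_cast Nat.succ_ne_zero m
  simp only [bcoef, poch_succ, Nat.factorial_succ]
  push_cast
  field_simp

/-- Pfaff–Saalschütz -/
lemma saalschutz (b c : ℂ) {e : ℂ} (he : notNonposInt e) (m : ℕ) :
    ∑ k ∈ Finset.range (m + 1), hcoef (e - b) (e - c) e k * bcoef (b + c - e) (m - k)
      = hcoef b c e m := by
  induction m with
  | zero => simp [hcoef, bcoef, poch_zero]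
  | succ m ih =>
    set x := hcoef (e - b) (e - c) e with hx
    set y := bcoef (b + c - e) with hy
    have h3 : e + m ≠ 0 := fun h => he m (by linear_combination h)
    have h4 : (m : ℂ) + 1 ≠ 0 := by exact_mod_cast Nat.succ_ne_zero m
    apply mul_right_cancel₀ (mul_ne_zero h4 h3)
    rw [hcoef_succ b c he, ← ih]
    let H : ℕ → ℂ := fun k => k * (e + k - 1) * x k * y (m + 1 - k)
    have key : ∀ k ∈ Finset.range (m + 1),
        ((m : ℂ) + 1) * (e + m) * (x k * y (m + 1 - k))
          - (b + m) * (c + m) * (x k * y (m - k)) = - (H (k + 1) - H k) := by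
      intro k hk
      obtain ⟨j, rfl⟩ := Nat.exists_eq_add_of_le (Nat.lt_succ_iff.mp (Finset.mem_range.mp hk))
      have e1 : k + j + 1 - k = j + 1 := by omega
      have e2 : k + j - k = j := by omega
      have e3 : k + j + 1 - (k + 1) = j := by omega
      have X := hcoef_succ (e - b) (e - c) he k
      have Y := bcoef_succ (b + c - e) j
      rw [← hx] at X
      rw [← hy] at Y
      simp only [H, e1, e2, e3]
      push_cast
      have hj : (j : ℂ) + 1 ≠ 0 := by exact_mod_cast Nat.succ_ne_zero j
      have Y' : y (j + 1) = (b + c - e + j) * y j / (j + 1) := by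
        rw [eq_div_iff hj, Y]
      have : ((k : ℂ) + 1) * (e + (k + 1) - 1) * x (k + 1) * y j
          = ((e - b + k) * (e - c + k) * x k) * y j := by rw [← X]; ring
      rw [this, Y']
      field_simp
      ring
    have S := Finset.sum_congr rfl key
    rw [Finset.sum_neg_distrib, Finset.sum_range_sub, Finset.sum_sub_distrib,
      ← Finset.mul_sum, ← Finset.mul_sum] at S
    rw [Finset.sum_range_succ]
    simp only [H] at S
    push_cast at S
    simp only [Nat.sub_self] at S ⊢
    linear_combination S

lemma poch_eq_eval (s : ℂ) (n : ℕ) : (ascPochhammer ℂ n).eval s = poch s n := by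
  induction n with
  | zero => simp [poch_zero]
  | succ n ih => rw [ascPochhammer_succ_eval, ih, poch_succ]

lemma hasSum_binom (s : ℂ) {t : ℝ} (h0 : 0 < t) (h1 : t < 1) :
    HasSum (fun n => bcoef s n * (t : ℂ) ^ n) ((1 - (t : ℂ)) ^ (-s)) := by
  have h := (Complex.one_div_one_sub_cpow_hasFPowerSeriesOnBall_zero s).hasSum (y := (t : ℂ))
    (by 
      rw [Metric.mem_eball, edist_zero_right, ← ofReal_norm, Complex.norm_real, Real.norm_of_nonneg h0.le]
      simpa using h1)
  simp only [zero_add, FormalMultilinearSeries.ofScalars_apply_eq] at h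
  rw [Complex.cpow_neg, ← one_div]
  refine h.congr_fun fun n => ?_
  rw [smul_eq_mul, ← Ring.multichoose_eq]
  have := Ring.factorial_nsmul_multichoose_eq_ascPochhammer s n
  rw [Polynomial.ascPochhammer_smeval_eq_eval, poch_eq_eval, nsmul_eq_mul] at this
  have h2 : (Nat.factorial n : ℂ) ≠ 0 := by exact_mod_cast Nat.factorial_ne_zero n
  rw [bcoef, ← this]
  field_simp

lemma poch_isBigO (s : ℂ) :
    (fun n : ℕ => poch s (n + 1)) =O[atTop] fun n : ℕ => (n : ℝ) ^ s.re * (Nat.factorial n : ℝ) := by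
  by_cases hs : notNonposInt s
  · have hG : Gamma s ≠ 0 := Complex.Gamma_ne_zero hs
    have h := ((GammaSeq_tendsto_Gamma s).inv₀ hG).isBigO_one ℝ
    have h2 : (fun n : ℕ => (n : ℂ) ^ s * (Nat.factorial n : ℂ)) =O[atTop]
        fun n : ℕ => (n : ℝ) ^ s.re * (Nat.factorial n : ℝ) := by
      refine IsBigO.of_bound 1 ?_
      filter_upwards [eventually_gt_atTop 0] with n hn
      rw [norm_mul, Complex.norm_natCast_cpow_of_pos hn, one_mul, norm_mul]
      simp
      exact mul_le_mul_of_nonneg_right (le_abs_self _) (by positivity)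
    refine (h.mul h2).congr' ?_ (by simp)
    filter_upwards [eventually_gt_atTop 0] with n hn
    have h3 := poch_ne_zero hs (n + 1)
    have h4 : (Nat.factorial n : ℂ) ≠ 0 := by exact_mod_cast Nat.factorial_ne_zero n
    have h5 : (n : ℂ) ^ s ≠ 0 := by
      rw [Complex.cpow_ne_zero_iff]; left; exact_mod_cast hn.ne'
    simp only [GammaSeq]
    change ((n : ℂ) ^ s * _ / poch s (n + 1))⁻¹ * _ = _
    field_simp
  · simp only [notNonposInt, not_forall, not_not] at hs
    obtain ⟨k, hk⟩ := hs
    refine IsBigO.of_bound 0 ?_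
    filter_upwards [eventually_ge_atTop k] with n hn
    have : poch s (n + 1) = 0 := by
      rw [poch, Finset.prod_eq_zero_iff]
      exact ⟨k, by simp; omega, by rw [hk]; ring⟩
    simp [this]

lemma isBigO_poch {s : ℂ} (hs : notNonposInt s) :
    (fun n : ℕ => (n : ℝ) ^ s.re * (Nat.factorial n : ℝ)) =O[atTop]
      (fun n : ℕ => poch s (n + 1)) := by
  have h := (GammaSeq_tendsto_Gamma s).isBigO_one ℝ
  have h2 : (fun n : ℕ => (n : ℝ) ^ s.re * (Nat.factorial n : ℝ)) =O[atTop]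
      (fun n : ℕ => (n : ℂ) ^ s * (Nat.factorial n : ℂ)) := by
    refine IsBigO.of_bound 1 ?_
    filter_upwards [eventually_gt_atTop 0] with n hn
    rw [norm_mul, norm_mul, Complex.norm_natCast_cpow_of_pos hn, one_mul]
    simp
    rw [abs_of_nonneg (by positivity)]
  refine h2.trans ?_
  refine (h.mul (isBigO_refl (fun n : ℕ => poch s (n + 1)) atTop).norm_right).congr' ?_ ?_ |>.of_norm_right
  · filter_upwards with n
    have h3 := poch_ne_zero hs (n + 1)
    simp only [GammaSeq]
    change ((n : ℂ) ^ s * _ / poch s (n + 1)) * _ = _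
    field_simp
  · simp

lemma poch_ratio_isBigO (s : ℂ) {r : ℂ} (hr : notNonposInt r) :
    (fun n : ℕ => poch s (n + 1) / poch r (n + 1)) =O[atTop]
      fun n : ℕ => (n : ℝ) ^ (s - r).re := by
  have h := (poch_isBigO s).mul ((isBigO_poch hr).inv_rev (by
    filter_upwards [eventually_gt_atTop 0] with n hn h0
    have : (n : ℝ) ^ r.re * (Nat.factorial n : ℝ) ≠ 0 := by positivity
    exact absurd h0 this))
  refine h.congr' (by simp [div_eq_mul_inv]) ?_
  filter_upwards [eventually_gt_atTop 0] with n hn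
  have : (0 : ℝ) < n := by exact_mod_cast hn
  rw [Complex.sub_re, Real.rpow_sub this]
  field_simp

lemma poch_one (n : ℕ) : poch 1 n = (Nat.factorial n : ℂ) := by
  induction n with
  | zero => simp [poch_zero]
  | succ n ih => rw [poch_succ, ih, Nat.factorial_succ]; push_cast; ring

lemma hcoef_isBigO (b c : ℂ) {e : ℂ} (he : notNonposInt e) :
    (fun n : ℕ => hcoef b c e (n + 1)) =O[atTop] fun n : ℕ => (n : ℝ) ^ ((b + c - e).re - 1) := by
  have h1 : notNonposInt 1 := notNonposInt_of_re_pos (by simp)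
  have h := (poch_ratio_isBigO b he).mul (poch_ratio_isBigO c h1)
  refine h.congr' ?_ ?_
  · filter_upwards with n
    rw [poch_one, hcoef]
    ring
  · filter_upwards [eventually_gt_atTop 0] with n hn
    have : (0 : ℝ) < n := by exact_mod_cast hn
    rw [← Real.rpow_add this]
    congr 1
    simp
    ring

lemma summable_hcoef_mul (b c : ℂ) {e : ℂ} (he : notNonposInt e) (s : ℂ) {r : ℂ}
    (hr : notNonposInt r) (h : 0 < (r - s + (e - b - c)).re) :
    Summable fun n => ‖hcoef b c e n * (poch s n / poch r n)‖ := by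
  rw [← summable_nat_add_iff 1]
  refine summable_of_isBigO_nat
    (g := fun n : ℕ => (n : ℝ) ^ ((b + c - e).re - 1 + (s - r).re)) ?_ ?_
  · rw [Real.summable_nat_rpow]
    simp at h ⊢
    linarith
  · refine (((hcoef_isBigO b c he).mul (poch_ratio_isBigO s hr)).congr' (by rfl) ?_).norm_left
    filter_upwards [eventually_gt_atTop 0] with n hn
    have : (0 : ℝ) < n := by exact_mod_cast hn
    rw [← Real.rpow_add this]

lemma summable_hcoef (b c : ℂ) {e : ℂ} (he : notNonposInt e)
    (h : 0 < ((e - b - c)).re) :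
    Summable fun n => ‖hcoef b c e n‖ := by
  have := summable_hcoef_mul b c he e he (by simpa using h)
  simpa [div_self (poch_ne_zero he _)] using this

lemma summable_hcoef_pow (b c : ℂ) {e : ℂ} (he : notNonposInt e) {t : ℝ} (h0 : 0 < t)
    (h1 : t < 1) : Summable fun n => ‖hcoef b c e n * (t : ℂ) ^ n‖ := by
  rw [← summable_nat_add_iff 1]
  obtain ⟨N, hN⟩ := exists_nat_ge ((b + c - e).re - 1)
  refine summable_of_isBigO_nat
    (g := fun n : ℕ => (n : ℝ) ^ N * t ^ n) (summable_pow_mul_geometric_of_norm_lt_one N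
      (by rwa [Real.norm_of_nonneg h0.le])) ?_
  refine IsBigO.norm_left ((hcoef_isBigO b c he).trans ?_ |>.mul ?_)
  · refine IsBigO.of_bound 1 ?_
    filter_upwards [eventually_gt_atTop 0] with n hn
    have : (1 : ℝ) ≤ n := by exact_mod_cast hn
    rw [Real.norm_of_nonneg (by positivity), Real.norm_of_nonneg (by positivity), one_mul,
      ← Real.rpow_natCast]
    exact Real.rpow_le_rpow_of_exponent_le this hN
  · refine IsBigO.of_bound 1 ?_
    filter_upwards with n
    simp only [norm_pow, Complex.norm_real, Real.norm_of_nonneg h0.le, one_mul]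
    exact pow_le_pow_of_le_one h0.le h1.le (by omega)

lemma bcoef_eq (s : ℂ) (n : ℕ) : bcoef s n = hcoef s 1 1 n := by
  have := poch_ne_zero (notNonposInt_of_re_pos (a := 1) (by simp)) n
  rw [bcoef, hcoef]
  field_simp

/-- Euler's transformation -/
lemma euler_transformation (b c : ℂ) {e : ℂ} (he : notNonposInt e) {t : ℝ} (h0 : 0 < t)
    (h1 : t < 1) : ∑' n, hcoef b c e n * (t : ℂ) ^ n =
      (1 - (t : ℂ)) ^ (e - b - c) * ∑' n, hcoef (e - b) (e - c) e n * (t : ℂ) ^ n := by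
  have hb := (hasSum_binom (b + c - e) h0 h1).tsum_eq
  rw [show -(b + c - e) = e - b - c by ring] at hb
  have hs : Summable fun n => ‖bcoef (b + c - e) n * (t : ℂ) ^ n‖ := by
    simp only [bcoef_eq]
    exact summable_hcoef_pow _ _ (notNonposInt_of_re_pos (by simp)) h0 h1
  rw [← hb, mul_comm, tsum_mul_tsum_eq_tsum_sum_range_of_summable_norm
    (summable_hcoef_pow _ _ he h0 h1) hs]
  refine tsum_congr fun n => ?_
  rw [← saalschutz b c he n, Finset.sum_mul]
  refine Finset.sum_congr rfl fun k hk => ?_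
  have : k + (n - k) = n := by have := Finset.mem_range.mp hk; omega
  nth_rw 2 [← this]
  rw [pow_add]
  ring

lemma Gamma_add_nat {z : ℂ} (hz : notNonposInt z) (n : ℕ) :
    Gamma (z + n) = Gamma z * poch z n := by
  induction n with
  | zero => simp [poch_zero]
  | succ n ih =>
    have : z + n ≠ 0 := fun h => hz n (by linear_combination h)
    rw [poch_succ]
    push_cast
    rw [← add_assoc, Complex.Gamma_add_one _ this, ih]
    ring

lemma beta_add_nat {u v : ℂ} (hu : 0 < u.re) (hv : 0 < v.re) (m n : ℕ) :
    betaIntegral (u + m) (v + n) =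
      Gamma u * Gamma v / Gamma (u + v) * (poch u m * poch v n / poch (u + v) (m + n)) := by
  have huv : 0 < (u + v).re := by rw [Complex.add_re]; positivity
  rw [betaIntegral_eq_Gamma_mul_div _ _ (by simp; positivity) (by simp; positivity),
    show u + m + (v + n) = (u + v) + ((m + n : ℕ) : ℂ) by push_cast; ring,
    Gamma_add_nat (notNonposInt_of_re_pos hu), Gamma_add_nat (notNonposInt_of_re_pos hv),
    Gamma_add_nat (notNonposInt_of_re_pos huv)]
  ring

/-- the integrand -/
lemma integrand_norm {u v : ℂ} {t : ℝ} (h0 : 0 < t) (h1 : t < 1) :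
    (((‖(t : ℂ) ^ (u - 1) * (1 - (t : ℂ)) ^ (v - 1)‖ : ℝ)) : ℂ) =
      (t : ℂ) ^ ((u.re : ℂ) - 1) * (1 - (t : ℂ)) ^ ((v.re : ℂ) - 1) := by
  have h2 : 0 < 1 - t := by linarith
  have e : (1 - (t : ℂ)) = ((1 - t : ℝ) : ℂ) := by push_cast; rfl
  rw [e, norm_mul, Complex.norm_cpow_eq_rpow_re_of_pos h0, Complex.norm_cpow_eq_rpow_re_of_pos h2]
  push_cast
  rw [Complex.ofReal_cpow h0.le, Complex.ofReal_cpow h2.le]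
  simp

lemma ae_Ioo : ∀ᵐ t : ℝ ∂(volume.restrict (Set.Ioo (0:ℝ) 1)), 0 < t ∧ t < 1 := by
  filter_upwards [ae_restrict_mem measurableSet_Ioo] with t ht using ht

lemma beta_Ioo (u v : ℂ) : betaIntegral u v =
    ∫ t : ℝ in Set.Ioo (0:ℝ) 1, (t : ℂ) ^ (u - 1) * (1 - (t : ℂ)) ^ (v - 1) := by
  rw [betaIntegral, intervalIntegral.integral_of_le zero_le_one, integral_Ioc_eq_integral_Ioo]

lemma beta_integrable {u v : ℂ} (hu : 0 < u.re) (hv : 0 < v.re) :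
    Integrable (fun t : ℝ => (t : ℂ) ^ (u - 1) * (1 - (t : ℂ)) ^ (v - 1))
      (volume.restrict (Set.Ioo (0:ℝ) 1)) := by
  have := betaIntegral_convergent hu hv
  rw [intervalIntegrable_iff_integrableOn_Ioo_of_le zero_le_one] at this
  exact this

lemma integral_norm_beta (u v : ℂ) :
    ((∫ t : ℝ in Set.Ioo (0:ℝ) 1, ‖(t : ℂ) ^ (u - 1) * (1 - (t : ℂ)) ^ (v - 1)‖ : ℝ) : ℂ)
      = betaIntegral u.re v.re := by
  rw [beta_Ioo, ← integral_complex_ofReal]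
  refine integral_congr_ae ?_
  filter_upwards [ae_Ioo] with t ht
  exact integrand_norm ht.1 ht.2

lemma main_integral {a δ : ℂ} (ha : 0 < a.re) (hδ : 0 < δ.re) (u v : ℕ → ℂ)
    (hu : Summable fun m => ‖u m * (poch a.re m / poch (a.re + δ.re) m)‖)
    (hup : ∀ t : ℝ, 0 < t → t < 1 → Summable fun m => ‖u m * (t : ℂ) ^ m‖)
    (hv : Summable fun n => ‖v n‖) :
    ∑' (m : ℕ) (n : ℕ), u m * v n * betaIntegral (a + m) (δ + n) =
      ∫ t : ℝ in Set.Ioo (0:ℝ) 1, (t : ℂ) ^ (a - 1) * (1 - (t : ℂ)) ^ (δ - 1) *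
        ((∑' m, u m * (t : ℂ) ^ m) * ∑' n, v n * (1 - (t : ℂ)) ^ n) := by
  let F : ℕ × ℕ → ℝ → ℂ := fun p t =>
    u p.1 * v p.2 * ((t : ℂ) ^ (a + p.1 - 1) * (1 - (t : ℂ)) ^ (δ + p.2 - 1))
  have hF_int : ∀ p, Integrable (F p) (volume.restrict (Set.Ioo (0:ℝ) 1)) := fun p =>
    (beta_integrable (by simp; positivity) (by simp; positivity)).const_mul _
  have hbound : ∀ p : ℕ × ℕ, ∫ t : ℝ in Set.Ioo (0:ℝ) 1, ‖F p t‖ ≤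
      ‖betaIntegral a.re δ.re‖ * (‖u p.1 * (poch a.re p.1 / poch (a.re + δ.re) p.1)‖ * ‖v p.2‖) := by
    rintro ⟨m, n⟩
    have hI := beta_integrable (u := a + m) (v := δ) (by simp; positivity) hδ
    have e1 : ∫ t : ℝ in Set.Ioo (0:ℝ) 1, ‖(t : ℂ) ^ (a + m - 1) * (1 - (t : ℂ)) ^ (δ - 1)‖
        = ‖betaIntegral a.re δ.re * (poch a.re m / poch (a.re + δ.re) m)‖ := by
      have h := integral_norm_beta (a + m) δ
      have h0 := beta_add_nat (u := a.re) (v := δ.re) (by simpa) (by simpa) m 0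
      have h00 := beta_add_nat (u := a.re) (v := δ.re) (by simpa) (by simpa) 0 0
      simp [poch_zero] at h0 h00
      rw [h00, ← h0]
      simp at h
      rw [← h, ← Complex.ofReal_natCast, Complex.norm_real, Real.norm_of_nonneg]
      · simp
      · positivity
    calc ∫ t : ℝ in Set.Ioo (0:ℝ) 1, ‖F (m, n) t‖
        ≤ ∫ t : ℝ in Set.Ioo (0:ℝ) 1,
          ‖u m‖ * ‖v n‖ * ‖(t : ℂ) ^ (a + m - 1) * (1 - (t : ℂ)) ^ (δ - 1)‖ := by
          refine integral_mono_ae (hF_int _).norm (hI.norm.const_mul _) ?_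
          filter_upwards [ae_Ioo] with t ht
          have h2 : 0 < 1 - t := by linarith [ht.2]
          have e : (1 - (t : ℂ)) = ((1 - t : ℝ) : ℂ) := by push_cast; rfl
          simp only [F, norm_mul]
          rw [e, Complex.norm_cpow_eq_rpow_re_of_pos h2 (δ - 1),
            Complex.norm_cpow_eq_rpow_re_of_pos h2 (δ + n - 1)]
          gcongr ‖u m‖ * ‖v n‖ * (‖(t : ℂ) ^ (a + m - 1)‖ * ?_)
          apply Real.rpow_le_rpow_of_exponent_ge h2 (by linarith [ht.1])
          simp
      _ = _ := by
          rw [integral_const_mul, e1, norm_mul, norm_mul]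
          ring
  have hsumB : Summable fun p : ℕ × ℕ =>
      ‖betaIntegral a.re δ.re‖ * (‖u p.1 * (poch a.re p.1 / poch (a.re + δ.re) p.1)‖ * ‖v p.2‖) :=
    (hu.mul_of_nonneg hv (fun _ => norm_nonneg _) (fun _ => norm_nonneg _)).mul_left _
  have hF_sum : Summable fun p => ∫ t : ℝ in Set.Ioo (0:ℝ) 1, ‖F p t‖ :=
    Summable.of_nonneg_of_le (fun p => by positivity) hbound hsumB
  have H := hasSum_integral_of_summable_integral_norm hF_int hF_sum
  have e2 : ∀ p : ℕ × ℕ, ∫ t : ℝ in Set.Ioo (0:ℝ) 1, F p t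
      = u p.1 * v p.2 * betaIntegral (a + p.1) (δ + p.2) := by
    intro p
    rw [beta_Ioo, ← integral_const_mul]
  simp only [e2] at H
  rw [← H.summable.tsum_prod (f := fun p : ℕ × ℕ =>
    u p.1 * v p.2 * betaIntegral (a + p.1) (δ + p.2)), H.tsum_eq]
  refine integral_congr_ae ?_
  filter_upwards [ae_Ioo] with t ht
  have h2 : 0 < 1 - t := by linarith [ht.2]
  have t0 : (t : ℂ) ≠ 0 := by exact_mod_cast ht.1.ne'
  have e : (1 - (t : ℂ)) = ((1 - t : ℝ) : ℂ) := by push_cast; rfl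
  have t1 : (1 - (t : ℂ)) ≠ 0 := by rw [e]; exact_mod_cast h2.ne'
  have hv' : Summable fun n => ‖v n * (1 - (t : ℂ)) ^ n‖ := by
    refine Summable.of_nonneg_of_le (fun _ => norm_nonneg _) (fun n => ?_) hv
    rw [norm_mul, norm_pow, e, Complex.norm_real, Real.norm_of_nonneg h2.le]
    exact mul_le_of_le_one_right (norm_nonneg _) (pow_le_one₀ h2.le (by linarith [ht.1]))
  rw [tsum_mul_tsum_of_summable_norm (hup t ht.1 ht.2) hv', ← tsum_mul_left]
  refine tsum_congr fun p => ?_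
  simp only [F]
  rw [show a + p.1 - 1 = a - 1 + p.1 by ring, show δ + p.2 - 1 = δ - 1 + p.2 by ring,
    Complex.cpow_add _ _ t0, Complex.cpow_add _ _ t1, Complex.cpow_natCast, Complex.cpow_natCast]
  ring

lemma one_side {a δ b c e b' c' e' : ℂ} (ha : 0 < a.re) (hδ : 0 < δ.re)
    (he : notNonposInt e) (hee : notNonposInt e')
    (h3 : 0 < (δ + e - b - c).re) (h4 : 0 < (e' - b' - c').re) :
    Gamma a * Gamma δ / Gamma (a + δ) *
    (∑' (m : ℕ) (n : ℕ), poch a m * poch δ n / poch (a + δ) (m + n) *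
      (hcoef b c e m * hcoef b' c' e' n)) =
      ∫ t : ℝ in Set.Ioo (0:ℝ) 1, (t : ℂ) ^ (a - 1) * (1 - (t : ℂ)) ^ (δ - 1) *
        ((∑' m, hcoef b c e m * (t : ℂ) ^ m) * ∑' n, hcoef b' c' e' n * (1 - (t : ℂ)) ^ n) := by
  rw [← main_integral ha hδ _ _ ?_ (fun t h0 h1 => summable_hcoef_pow b c he h0 h1)
    (summable_hcoef _ _ hee h4), ← tsum_mul_left]
  · refine tsum_congr fun m => ?_
    rw [← tsum_mul_left]
    refine tsum_congr fun n => ?_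
    rw [beta_add_nat ha hδ]
    ring
  · apply summable_hcoef_mul _ _ he
    · apply notNonposInt_of_re_pos
      simp; positivity
    · simp at h3 ⊢
      linarith

theorem kdf_intermediate_transformation (d a b c e b' c' e' : ℂ)
    (h1 : 0 < a.re) (h2 : 0 < (d - a).re) (h3 : 0 < (d + e - a - b - c).re)
    (h4 : 0 < (e' - b' - c').re)
    (hd : notNonposInt d) (he : notNonposInt e) (hee : notNonposInt e')
    (hdd : notNonposInt (d + e - b - c)) :
    (∑' (m : ℕ) (n : ℕ),
        poch a m * poch b m * poch c m * poch (d - a) n * poch b' n * poch c' n /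
          (poch d (m + n) * poch e m * poch e' n *
            (Nat.factorial m : ℂ) * (Nat.factorial n : ℂ))) =
      Complex.Gamma d * Complex.Gamma (d + e - a - b - c) /
          (Complex.Gamma (d - a) * Complex.Gamma (d + e - b - c)) *
        ∑' (m : ℕ) (n : ℕ),
          poch a m * poch (e - b) m * poch (e - c) m *
              poch b' n * poch c' n * poch (d + e - a - b - c) n /
            (poch e m * poch e' n * poch (d + e - b - c) (m + n) *
              (Nat.factorial m : ℂ) * (Nat.factorial n : ℂ)) := by
  have e1 : a + (d - a) = d := by ring
  have e2 : a + (d + e - a - b - c) = d + e - b - c := by ring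
  have L := one_side (a := a) (δ := d - a) (b := b) (c := c) (e := e) (b' := b') (c' := c')
    (e' := e') h1 h2 he hee (by convert h3 using 2; ring) h4
  have R := one_side (a := a) (δ := d + e - a - b - c) (b := e - b) (c := e - c) (e := e)
    (b' := b') (c' := c') (e' := e') h1 h3 he hee (by convert h2 using 2; ring) h4
  have I : ∫ t : ℝ in Set.Ioo (0:ℝ) 1, (t : ℂ) ^ (a - 1) * (1 - (t : ℂ)) ^ (d - a - 1) *
        ((∑' m, hcoef b c e m * (t : ℂ) ^ m) * ∑' n, hcoef b' c' e' n * (1 - (t : ℂ)) ^ n) =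
      ∫ t : ℝ in Set.Ioo (0:ℝ) 1, (t : ℂ) ^ (a - 1) * (1 - (t : ℂ)) ^ (d + e - a - b - c - 1) *
        ((∑' m, hcoef (e - b) (e - c) e m * (t : ℂ) ^ m) *
          ∑' n, hcoef b' c' e' n * (1 - (t : ℂ)) ^ n) := by
    refine integral_congr_ae ?_
    filter_upwards [ae_Ioo] with t ht
    have t1 : (1 - (t : ℂ)) ≠ 0 := by
      rw [sub_ne_zero]; exact_mod_cast ht.2.ne'
    rw [euler_transformation b c he ht.1 ht.2,
      show d + e - a - b - c - 1 = (d - a - 1) + (e - b - c) by ring, Complex.cpow_add _ _ t1]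
    ring
  rw [I, ← R, e1, e2] at L
  have g1 := Complex.Gamma_ne_zero_of_re_pos h1
  have g2 := Complex.Gamma_ne_zero_of_re_pos h2
  have g3 : Gamma d ≠ 0 := Complex.Gamma_ne_zero hd
  have g4 : Gamma (d + e - b - c) ≠ 0 := Complex.Gamma_ne_zero hdd
  have s1 : ∀ m n : ℕ,
      poch a m * poch b m * poch c m * poch (d - a) n * poch b' n * poch c' n /
          (poch d (m + n) * poch e m * poch e' n *
            (Nat.factorial m : ℂ) * (Nat.factorial n : ℂ)) =
      poch a m * poch (d - a) n / poch d (m + n) * (hcoef b c e m * hcoef b' c' e' n) := by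
    intro m n
    simp only [hcoef, div_eq_mul_inv, mul_inv]
    ring
  have s2 : ∀ m n : ℕ,
      poch a m * poch (e - b) m * poch (e - c) m *
              poch b' n * poch c' n * poch (d + e - a - b - c) n /
            (poch e m * poch e' n * poch (d + e - b - c) (m + n) *
              (Nat.factorial m : ℂ) * (Nat.factorial n : ℂ)) =
      poch a m * poch (d + e - a - b - c) n / poch (d + e - b - c) (m + n) *
        (hcoef (e - b) (e - c) e m * hcoef b' c' e' n) := by
    intro m n
    simp only [hcoef, div_eq_mul_inv, mul_inv]
    ring
  simp only [s1, s2]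
  generalize (∑' (m : ℕ) (n : ℕ), poch a m * poch (d - a) n / poch d (m + n) *
    (hcoef b c e m * hcoef b' c' e' n)) = X at L ⊢
  generalize (∑' (m : ℕ) (n : ℕ), poch a m * poch (d + e - a - b - c) n / poch (d + e - b - c) (m + n) *
    (hcoef (e - b) (e - c) e m * hcoef b' c' e' n)) = Y at L ⊢
  field_simp at L ⊢
  linear_combination L
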